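/- (Proposition 5.1) Let G be an IMM-consistent execution graph all of whose non-initialization events are relaxed non-exclusive reads or relaxed normal writes (in particular G has no fences and G.rmw = ∅), and let ⟨C, I⟩ be a relaxed traversal configuration of G. Then G ⊢ ⟨C, I⟩ →* ⟨E, W⟩, i.e., the relaxed traversal steps can reach the configuration in which every event is covered and every write is issued. -/

import Mathlib

/-! ## Basic definitions: events, labels, relations -/

abbrev Loc := ℕ
abbrev Val := ℕ

inductive Mode
  | rlx | acq | rel | acqrel | sc
deriving DecidableEq

inductive ExFlag
  | notex | ex
deriving DecidableEq

inductive Strength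
  | normal | strong
deriving DecidableEq

inductive Label
  | read (o : Mode) (x : Loc) (v : Val) (s : ExFlag)
  | write (o : Mode) (x : Loc) (v : Val) (st : Strength)
  | fence (o : Mode)
deriving DecidableEq

inductive Event
  | init (x : Loc)
  | ev (tid : ℕ) (sn : ℚ)
deriving DecidableEq

def Event.isInit : Event → Prop
  | .init _ => True
  | .ev _ _ => False

/-- the set of initialization events -/
def InitE : Set Event := {e | e.isInit}

/-- the `sequenced-before` partial order on events: initialization events precede all
non-initialization events, and events of the same thread are ordered by serial number -/
def evLt : Event → Event → Prop
  | .init _, .ev _ _ => True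
  | .ev i n, .ev j m => i = j ∧ n < m
  | _, _ => False

abbrev REv := Event → Event → Prop

/-- relational composition `r ; s` -/
def seqR (r s : REv) : REv := fun a c => ∃ b, r a b ∧ s b c

infixr:70 " ⬝ " => seqR

/-- identity relation on a set: `[A]` -/
def eqv (A : Set Event) : REv := fun a b => a = b ∧ a ∈ A

notation:max "⦗" A "⦘" => eqv A

/-- union of relations -/
def runion (r s : REv) : REv := fun a b => r a b ∨ s a b

infixl:65 " ∪ᵣ " => runion

/-- reflexive closure `r^?` -/
def rcl (r : REv) : REv := fun a b => a = b ∨ r a b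

/-- transitive closure `r⁺` -/
def tcl (r : REv) : REv := Relation.TransGen r

/-- reflexive-transitive closure `r*` -/
def rtcl (r : REv) : REv := Relation.ReflTransGen r

/-- inverse relation `r⁻¹` -/
def transp (r : REv) : REv := fun a b => r b a

def rdom (r : REv) : Set Event := {a | ∃ b, r a b}

def rcodom (r : REv) : Set Event := {b | ∃ a, r a b}

/-- immediate edges: `imm(r) = r ∖ r;r` -/
def immediate (r : REv) : REv := fun a b => r a b ∧ ¬ (r ⬝ r) a b

def acyclic (r : REv) : Prop := Irreflexive (tcl r)

/-- `r` totally orders `A` -/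
def totalOn (A : Set Event) (r : REv) : Prop :=
  ∀ a ∈ A, ∀ b ∈ A, a ≠ b → r a b ∨ r b a

def Label.locOf : Label → Option Loc
  | .read _ x _ _ => some x
  | .write _ x _ _ => some x
  | .fence _ => none

def Label.valOf : Label → Option Val
  | .read _ _ v _ => some v
  | .write _ _ v _ => some v
  | .fence _ => none

/-! ## IMM execution graphs -/

structure Execution where
  E : Set Event
  lab : Event → Label
  rmw : REv
  data : REv
  addr : REv
  ctrl : REv
  casdep : REv
  rf : REv
  co : REv

namespace Execution

variable (G : Execution)

def loc (e : Event) : Option Loc := (G.lab e).locOf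
def valu (e : Event) : Option Val := (G.lab e).valOf

/-- read events -/
def R : Set Event := {e | e ∈ G.E ∧ ∃ o x v s, G.lab e = .read o x v s}
/-- write events -/
def W : Set Event := {e | e ∈ G.E ∧ ∃ o x v st, G.lab e = .write o x v st}
/-- fence events -/
def F : Set Event := {e | e ∈ G.E ∧ ∃ o, G.lab e = .fence o}
/-- acquire reads -/
def Racq : Set Event := {e | e ∈ G.E ∧ ∃ x v s, G.lab e = .read .acq x v s}
/-- exclusive reads -/
def Rex : Set Event := {e | e ∈ G.E ∧ ∃ o x v, G.lab e = .read o x v .ex}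
/-- release writes -/
def Wrel : Set Event := {e | e ∈ G.E ∧ ∃ x v st, G.lab e = .write .rel x v st}
/-- strong writes -/
def Wstrong : Set Event := {e | e ∈ G.E ∧ ∃ o x v, G.lab e = .write o x v .strong}
/-- writes to location `x` -/
def Wloc (x : Loc) : Set Event := {e | e ∈ G.W ∧ G.loc e = some x}
/-- reads from location `x` -/
def Rloc (x : Loc) : Set Event := {e | e ∈ G.R ∧ G.loc e = some x}
/-- SC fences -/
def Fsc : Set Event := {e | e ∈ G.E ∧ G.lab e = .fence .sc}
/-- fences of mode exactly `rel` -/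
def Frel : Set Event := {e | e ∈ G.E ∧ G.lab e = .fence .rel}
/-- fences whose mode is at least `rel` (i.e. `rel`, `acqrel` or `sc`) -/
def FgeRel : Set Event :=
  {e | e ∈ G.E ∧ (G.lab e = .fence .rel ∨ G.lab e = .fence .acqrel ∨ G.lab e = .fence .sc)}
/-- fences whose mode is at least `acq` (i.e. `acq`, `acqrel` or `sc`) -/
def FgeAcq : Set Event :=
  {e | e ∈ G.E ∧ (G.lab e = .fence .acq ∨ G.lab e = .fence .acqrel ∨ G.lab e = .fence .sc)}

/-- program order -/
def po : REv := fun a b => a ∈ G.E ∧ b ∈ G.E ∧ evLt a b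

/-- both events access the same location -/
def sameLoc : REv := fun a b => ∃ x, G.loc a = some x ∧ G.loc b = some x

/-- `po|loc` -/
def poloc : REv := fun a b => G.po a b ∧ G.sameLoc a b

def rfi : REv := fun a b => G.rf a b ∧ G.po a b
def rfe : REv := fun a b => G.rf a b ∧ ¬ G.po a b
def coi : REv := fun a b => G.co a b ∧ G.po a b
def coe : REv := fun a b => G.co a b ∧ ¬ G.po a b

/-- from-read -/
def fr : REv := transp G.rf ⬝ G.co
def fri : REv := fun a b => G.fr a b ∧ G.po a b
def fre : REv := fun a b => G.fr a b ∧ ¬ G.po a b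

/-- release sequence -/
def rs : REv :=
  ⦗G.W⦘ ⬝ G.poloc ⬝ ⦗G.W⦘ ∪ᵣ ⦗G.W⦘ ⬝ rtcl (rcl G.poloc ⬝ G.rf ⬝ G.rmw)

/-- release prefix -/
def release : REv := (⦗G.Wrel⦘ ∪ᵣ ⦗G.FgeRel⦘ ⬝ G.po) ⬝ G.rs

/-- synchronizes with -/
def sw : REv :=
  G.release ⬝ (G.rfi ∪ᵣ rcl G.poloc ⬝ G.rfe) ⬝ (⦗G.Racq⦘ ∪ᵣ G.po ⬝ ⦗G.FgeAcq⦘)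

/-- happens-before -/
def hb : REv := tcl (G.po ∪ᵣ G.sw)

/-- extended coherence order -/
def eco : REv := G.rf ∪ᵣ G.co ⬝ rcl G.rf ∪ᵣ G.fr ⬝ rcl G.rf

/-- barrier order -/
def bob : REv :=
  G.po ⬝ ⦗G.Wrel⦘ ∪ᵣ ⦗G.Racq⦘ ⬝ G.po ∪ᵣ G.po ⬝ ⦗G.F⦘ ∪ᵣ ⦗G.F⦘ ⬝ G.po ∪ᵣ
    ⦗G.Wrel⦘ ⬝ G.poloc ⬝ ⦗G.W⦘

/-- syntactic dependencies -/
def deps : REv :=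
  G.data ∪ᵣ G.ctrl ∪ᵣ G.addr ⬝ rcl G.po ∪ᵣ G.casdep ∪ᵣ ⦗G.Rex⦘ ⬝ G.po

/-- preserved program order -/
def ppo : REv := ⦗G.R⦘ ⬝ tcl (G.deps ∪ᵣ G.rfi) ⬝ ⦗G.W⦘

def detour : REv := fun a b => (G.coe ⬝ G.rfe) a b ∧ G.po a b

/-- partial SC fence order -/
def psc : REv := ⦗G.Fsc⦘ ⬝ G.hb ⬝ G.eco ⬝ G.hb ⬝ ⦗G.Fsc⦘

/-- the acyclicity relation of IMM -/
def ar : REv :=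
  G.rfe ∪ᵣ G.bob ∪ᵣ G.ppo ∪ᵣ G.detour ∪ᵣ G.psc ∪ᵣ ⦗G.Wstrong⦘ ⬝ G.po ⬝ ⦗G.W⦘

/-! RC11-style variants -/

def rsRC11 : REv := ⦗G.W⦘ ⬝ rcl G.poloc ⬝ rtcl (G.rf ⬝ G.rmw)

def releaseRC11 : REv := (⦗G.Wrel⦘ ∪ᵣ ⦗G.FgeRel⦘ ⬝ G.po) ⬝ G.rsRC11

def swRC11 : REv := G.releaseRC11 ⬝ G.rf ⬝ (⦗G.Racq⦘ ∪ᵣ G.po ⬝ ⦗G.FgeAcq⦘)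

def hbRC11 : REv := tcl (G.po ∪ᵣ G.swRC11)

end Execution

/-- Well-formedness of an IMM execution graph -/
structure ExecWf (G : Execution) : Prop where
  finE : G.E.Finite
  init_lab : ∀ x, Event.init x ∈ G.E →
    G.lab (Event.init x) = Label.write .rlx x 0 .normal
  read_mode : ∀ e ∈ G.E, ∀ o x v s, G.lab e = .read o x v s → o = Mode.rlx ∨ o = Mode.acq
  write_mode : ∀ e ∈ G.E, ∀ o x v st, G.lab e = .write o x v st → o = Mode.rlx ∨ o = Mode.rel
  fence_mode : ∀ e ∈ G.E, ∀ o, G.lab e = .fence o →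
    o = Mode.acq ∨ o = Mode.rel ∨ o = Mode.acqrel ∨ o = Mode.sc
  rmw_sub : ∀ a b, G.rmw a b → a ∈ G.Rex ∧ b ∈ G.W ∧ G.sameLoc a b ∧ immediate G.po a b
  strong_rmw : G.Wstrong ⊆ rcodom G.rmw
  data_sub : ∀ a b, G.data a b → a ∈ G.R ∧ G.po a b ∧ b ∈ G.W
  addr_sub : ∀ a b, G.addr a b → a ∈ G.R ∧ G.po a b ∧ (b ∈ G.R ∨ b ∈ G.W)
  ctrl_sub : ∀ a b, G.ctrl a b → a ∈ G.R ∧ G.po a b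
  ctrl_po : ∀ a b c, G.ctrl a b → G.po b c → G.ctrl a c
  casdep_sub : ∀ a b, G.casdep a b → a ∈ G.R ∧ G.po a b ∧ b ∈ G.Rex
  rf_sub : ∀ a b, G.rf a b → a ∈ G.W ∧ b ∈ G.R ∧ G.sameLoc a b
  rf_val : ∀ a b, G.rf a b → G.valu a = G.valu b
  rf_func : ∀ a b c, G.rf a c → G.rf b c → a = b
  co_sub : ∀ a b, G.co a b → a ∈ G.W ∧ b ∈ G.W ∧ G.sameLoc a b
  co_trans : Transitive G.co
  co_irr : Irreflexive G.co

/-- IMM-consistency (Definition 3.1) -/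
def IMMConsistent (G : Execution) : Prop :=
  rcodom G.rf = G.R ∧
  (∀ x, totalOn (G.Wloc x) G.co) ∧
  Irreflexive (G.hb ⬝ rcl G.eco) ∧
  (∀ a b, G.rmw a b → ¬ (G.fre ⬝ G.coe) a b) ∧
  acyclic G.ar

/-! ## Relaxed traversal -/

/-- Issuable events (relaxed fragment): writes all of whose `rf_e;ppo`-predecessors
have been issued. -/
def RIssuable (G : Execution) (C I : Set Event) : Set Event :=
  {w | w ∈ G.W ∧ ∀ a, (G.rfe ⬝ G.ppo) a w → a ∈ I}

/-- Coverable events (relaxed fragment). -/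
def RCoverable (G : Execution) (C I : Set Event) : Set Event :=
  {e | e ∈ G.E ∧ (∀ a, G.po a e → a ∈ C) ∧
    ((e ∈ G.W ∧ e ∈ I) ∨ (e ∈ G.R ∧ ∀ a, G.rf a e → a ∈ I))}

/-- Relaxed traversal steps. -/
inductive RTravStep (G : Execution) :
    Set Event × Set Event → Set Event × Set Event → Prop
  | issue {C I : Set Event} {w : Event} :
      w ∈ RIssuable G C I → w ∉ I → RTravStep G (C, I) (C, insert w I)
  | cover {C I : Set Event} {e : Event} :
      e ∈ RCoverable G C I → e ∉ C → RTravStep G (C, I) (insert e C, I)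

/-- `⟨C, I⟩` is a relaxed traversal configuration of `G`. -/
def RTravConfig (G : Execution) (C I : Set Event) : Prop :=
  G.E ∩ InitE ⊆ C ∧ C ∩ G.W ⊆ I ∧
  I ⊆ RIssuable G C I ∧ C ⊆ RCoverable G C I

/-- All non-initialization events of `G` are relaxed non-exclusive reads or
relaxed normal writes. -/
def RlxRWOnly (G : Execution) : Prop :=
  ∀ e ∈ G.E, ¬ e.isInit →
    (∃ x v, G.lab e = .read .rlx x v .notex) ∨ (∃ x v, G.lab e = .write .rlx x v .normal)

/-- If a finite set `T` can be traversed one element at a time, each step being allowed once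
all predecessors in `T` under a strict order `r` have been added, then all of `T` is reached. -/
theorem reflTransGen_of_finite_strictOrder {α β : Type*} {step : β → β → Prop} (f : Set α → β)
    (r : α → α → Prop) [IsStrictOrder α r] {T : Set α} (hT : T.Finite)
    (hstep : ∀ S ⊆ T, ∀ a ∈ T \ S, (∀ b ∈ T, r b a → b ∈ S) → step (f S) (f (insert a S)))
    {S : Set α} (hS : S ⊆ T) : Relation.ReflTransGen step (f S) (f T) := by
  induction hn : (T \ S).ncard generalizing S with
  | zero =>
    have hTS : T \ S = ∅ := (Set.ncard_eq_zero hT.sdiff).1 hn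
    rw [hS.antisymm (Set.sdiff_eq_empty.1 hTS)]
  | succ n ih =>
    have hne : (T \ S).Nonempty := (Set.ncard_pos hT.sdiff).1 (by omega)
    have hwf : (T \ S).WellFoundedOn r := hT.sdiff.wellFoundedOn
    obtain ⟨⟨a, ha⟩, -, hmin⟩ := WellFounded.has_min hwf Set.univ ⟨⟨_, hne.some_mem⟩, trivial⟩
    refine .head (hstep S hS a ha fun b hb hba => ?_)
      (ih (Set.insert_subset ha.1 hS) ?_)
    · by_contra hbS
      exact hmin ⟨b, hb, hbS⟩ trivial hba
    · have hcard := Set.ncard_sdiff_singleton_add_one ha hT.sdiff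
      have hset : T \ insert a S = (T \ S) \ {a} := by
        ext x
        simp only [Set.mem_sdiff, Set.mem_insert_iff, Set.mem_singleton_iff]
        tauto
      rw [hset]
      omega

theorem evLt_isStrictOrder : IsStrictOrder Event evLt where
  irrefl a := by cases a <;> simp [evLt]
  trans a b c := by
    cases a <;> cases b <;> cases c <;> simp only [evLt] <;> grind

theorem Execution.mem_R_or_mem_W {G : Execution} (hwf : ExecWf G) (hrlx : RlxRWOnly G)
    {e : Event} (he : e ∈ G.E) : e ∈ G.R ∨ e ∈ G.W := by
  by_cases hi : e.isInit
  · cases e with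
    | init x => exact .inr ⟨he, _, _, _, _, hwf.init_lab x he⟩
    | ev => exact hi.elim
  · obtain ⟨x, v, h⟩ | ⟨x, v, h⟩ := hrlx e he hi
    · exact .inl ⟨he, _, _, _, _, h⟩
    · exact .inr ⟨he, _, _, _, _, h⟩

/-- All writes can be issued, because `rf_e ; ppo ⊆ ar⁺`. -/
theorem reflTransGen_issue_all {G : Execution} (hwf : ExecWf G) (hcons : IMMConsistent G)
    (C : Set Event) {I : Set Event} (hI : I ⊆ G.W) :
    Relation.ReflTransGen (RTravStep G) (C, I) (C, G.W) := by
  have : IsStrictOrder Event (tcl G.ar) :=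
    { irrefl := hcons.2.2.2.2
      trans := fun _ _ _ => Relation.TransGen.trans }
  refine reflTransGen_of_finite_strictOrder (fun I => (C, I)) (tcl G.ar)
    (hwf.finE.subset fun _ h => h.1) (fun S _ w hw hpred => ?_) hI
  refine .issue ⟨hw.1, fun a ha => ?_⟩ hw.2
  obtain ⟨b, hab, hbw⟩ := ha
  have hrfe : G.ar a b := .inl (.inl (.inl (.inl (.inl hab))))
  have hppo : G.ar b w := .inl (.inl (.inl (.inr hbw)))
  exact hpred a (hwf.rf_sub _ _ hab.1).1 (.tail (.single hrfe) hppo)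

/-- Once all writes are issued, all events can be covered in program order. -/
theorem reflTransGen_cover_all {G : Execution} (hwf : ExecWf G) (hrlx : RlxRWOnly G)
    {C : Set Event} (hC : C ⊆ G.E) :
    Relation.ReflTransGen (RTravStep G) (C, G.W) (G.E, G.W) := by
  have := evLt_isStrictOrder
  refine reflTransGen_of_finite_strictOrder (fun C => (C, G.W)) evLt hwf.finE
    (fun S _ e he hpred => ?_) hC
  refine .cover ⟨he.1, fun a ha => hpred a ha.1 ha.2.2, ?_⟩ he.2
  obtain h | h := Execution.mem_R_or_mem_W hwf hrlx he.1
  · exact .inr ⟨h, fun a ha => (hwf.rf_sub _ _ ha).1⟩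
  · exact .inl ⟨h, h⟩

/-- Proposition 5.1: for an IMM-consistent execution graph all of whose
non-initialization events are relaxed non-exclusive reads or relaxed normal writes
(in particular `G` has no fences and `G.rmw = ∅`), and any relaxed traversal
configuration `⟨C, I⟩` of `G`, the relaxed traversal steps can reach the final
configuration `⟨E, W⟩`. -/
theorem rlx_traversal_exists (G : Execution) (hwf : ExecWf G)
    (hcons : IMMConsistent G) (hrlx : RlxRWOnly G)
    (C I : Set Event) (htc : RTravConfig G C I) :
    Relation.ReflTransGen (RTravStep G) (C, I) (G.E, G.W) := by
  exact (reflTransGen_issue_all hwf hcons C fun _ h => (htc.2.2.1 h).1).trans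
    (reflTransGen_cover_all hwf hrlx fun _ h => (htc.2.2.2 h).1)
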